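/- arXiv:2303.10633 — 2 statements merged into one kernel-verified Lean document; each statement's English description precedes it below -/
import Mathlib

section
/- If a strictly polytopic system is poly-quadratically detectable, then there exist symmetric positive definite matrices P̄_i ∈ ℝ^{n_x×n_x} (i = 1,…,N) such that P̄_i − A_iᵀP̄_jA_i + CᵀC is positive definite for all i, j ∈ {1,…,N}. -/
open Matrix

/-- The polytopic system with output matrix `C` is poly-quadratically detectable:
some observer gain `L` renders the error system `e_{k+1} = (A(p_k)+L(k,p)C)e_k`
poly-quadratically stable with a poly-quadratic Lyapunov function built from
symmetric matrices `P̄ᵢ`. -/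
def PolyQDetectable (nx ny np N : ℕ) (Pset : Set (Fin np → ℝ))
    (ξ : Fin N → Pset → ℝ) (A : Fin N → Matrix (Fin nx) (Fin nx) ℝ)
    (C : Matrix (Fin ny) (Fin nx) ℝ) : Prop :=
  ∃ (L : ℕ → (ℕ → Pset) → Matrix (Fin nx) (Fin ny) ℝ)
    (Pb : Fin N → Matrix (Fin nx) (Fin nx) ℝ),
    (∀ i, (Pb i).IsSymm) ∧
    ∃ a₁ a₂ a₃ : ℝ, 0 < a₁ ∧ 0 < a₂ ∧ 0 < a₃ ∧
      (∀ (π : Pset) (e : Fin nx → ℝ),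
        a₁ * (e ⬝ᵥ e) ≤ e ⬝ᵥ ((∑ i, ξ i π • Pb i) *ᵥ e) ∧
        e ⬝ᵥ ((∑ i, ξ i π • Pb i) *ᵥ e) ≤ a₂ * (e ⬝ᵥ e)) ∧
      (∀ (p : ℕ → Pset) (k : ℕ) (e : Fin nx → ℝ),
        (((∑ i, ξ i (p k) • A i) + L k p * C) *ᵥ e) ⬝ᵥ
            ((∑ i, ξ i (p (k + 1)) • Pb i) *ᵥ
              (((∑ i, ξ i (p k) • A i) + L k p * C) *ᵥ e))
          ≤ e ⬝ᵥ ((∑ i, ξ i (p k) • Pb i) *ᵥ e) - a₃ * (e ⬝ᵥ e))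

/-- The squared Euclidean norm of `L *ᵥ z` is at most a constant multiple of that of `z`. -/
lemma Matrix.exists_mulVec_dotProduct_self_le {m n : Type*} [Fintype m] [Fintype n]
    (L : Matrix m n ℝ) :
    ∃ K : ℝ, 0 ≤ K ∧ ∀ z : n → ℝ, (L *ᵥ z) ⬝ᵥ (L *ᵥ z) ≤ K * (z ⬝ᵥ z) := by
  refine ⟨∑ r, ∑ s, L r s ^ 2, by positivity, fun z => ?_⟩
  simp only [Matrix.mulVec, dotProduct, ← pow_two]
  rw [Finset.sum_mul]
  exact Finset.sum_le_sum fun r _ => Finset.sum_mul_sq_le_sq_mul_sq _ _ _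

/-- Young's inequality for the quadratic form of a positive semidefinite symmetric matrix. -/
lemma Matrix.IsSymm.dotProduct_mulVec_sub_le {n : Type*} [Fintype n] {P : Matrix n n ℝ}
    (hP : P.IsSymm) (hnonneg : ∀ x : n → ℝ, 0 ≤ x ⬝ᵥ (P *ᵥ x)) {ε : ℝ} (hε : 0 < ε)
    (x y : n → ℝ) :
    (x - y) ⬝ᵥ (P *ᵥ (x - y)) ≤
      (1 + ε) * (x ⬝ᵥ (P *ᵥ x)) + (1 + ε⁻¹) * (y ⬝ᵥ (P *ᵥ y)) := by
  have hcomm : y ⬝ᵥ (P *ᵥ x) = x ⬝ᵥ (P *ᵥ y) := by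
    rw [dotProduct_mulVec, ← mulVec_transpose, hP.eq, dotProduct_comm]
  have h := mul_nonneg (inv_pos.2 hε).le (hnonneg (ε • x + y))
  simp only [mulVec_add, mulVec_sub, mulVec_smul, dotProduct_add, add_dotProduct,
    dotProduct_sub, sub_dotProduct, dotProduct_smul, smul_dotProduct, smul_eq_mul, hcomm] at h ⊢
  field_simp at h ⊢
  linarith

/-- If output injection makes the quadratic form of `Q` decrease strictly, then the open-loop
form decreases strictly up to a multiple of the squared output. -/
lemma exists_output_penalty {m n : Type*} [Fintype m] [Fintype n]
    {A P Q : Matrix n n ℝ} {L : Matrix n m ℝ} {C : Matrix m n ℝ} {a b : ℝ}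
    (hQ : Q.IsSymm) (ha : 0 < a) (hb : 0 < b)
    (hQ0 : ∀ e : n → ℝ, 0 ≤ e ⬝ᵥ (Q *ᵥ e))
    (hQb : ∀ e : n → ℝ, e ⬝ᵥ (Q *ᵥ e) ≤ b * (e ⬝ᵥ e))
    (hPb : ∀ e : n → ℝ, e ⬝ᵥ (P *ᵥ e) ≤ b * (e ⬝ᵥ e))
    (hdec : ∀ e : n → ℝ, ((A + L * C) *ᵥ e) ⬝ᵥ (Q *ᵥ ((A + L * C) *ᵥ e)) ≤
      e ⬝ᵥ (P *ᵥ e) - a * (e ⬝ᵥ e)) :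
    ∃ c : ℝ, 0 ≤ c ∧ ∀ e : n → ℝ, (A *ᵥ e) ⬝ᵥ (Q *ᵥ (A *ᵥ e)) ≤
      e ⬝ᵥ (P *ᵥ e) - a / 2 * (e ⬝ᵥ e) + c * ((C *ᵥ e) ⬝ᵥ (C *ᵥ e)) := by
  obtain ⟨K, hK, hL⟩ := L.exists_mulVec_dotProduct_self_le
  have hε : 0 < a / (2 * b) := by positivity
  refine ⟨(1 + (a / (2 * b))⁻¹) * (b * K), by positivity, fun e => ?_⟩
  have hA : A *ᵥ e = (A + L * C) *ᵥ e - L *ᵥ (C *ᵥ e) := by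
    rw [add_mulVec, mulVec_mulVec, add_sub_cancel_right]
  have he : 0 ≤ e ⬝ᵥ e := by simpa using dotProduct_star_self_nonneg e
  have hx : (1 + a / (2 * b)) * (((A + L * C) *ᵥ e) ⬝ᵥ (Q *ᵥ ((A + L * C) *ᵥ e))) ≤
      e ⬝ᵥ (P *ᵥ e) - a / 2 * (e ⬝ᵥ e) := by
    have h := mul_le_mul_of_nonneg_left (hdec e) (by positivity : 0 ≤ 1 + a / (2 * b))
    have h' := mul_le_mul_of_nonneg_left (hPb e) hε.le
    have hab : a / (2 * b) * (b * (e ⬝ᵥ e)) = a / 2 * (e ⬝ᵥ e) := by field_simp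
    have h'' : 0 ≤ a / (2 * b) * (a * (e ⬝ᵥ e)) := by positivity
    linarith
  have hy : (L *ᵥ (C *ᵥ e)) ⬝ᵥ (Q *ᵥ (L *ᵥ (C *ᵥ e))) ≤
      b * K * ((C *ᵥ e) ⬝ᵥ (C *ᵥ e)) := by
    rw [mul_assoc]
    exact (hQb _).trans (mul_le_mul_of_nonneg_left (hL _) hb.le)
  rw [hA, mul_assoc]
  exact (hQ.dotProduct_mulVec_sub_le hQ0 hε _ _).trans
    (add_le_add hx (mul_le_mul_of_nonneg_left hy (by positivity)))

/-- Theorem 1 (necessity): if a strictly polytopic system is poly-quadratically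
detectable, then there exist `P̄ᵢ ≻ 0` with `P̄ᵢ - AᵢᵀP̄ⱼAᵢ + CᵀC ≻ 0` for all
`i,j`. -/
theorem polyQ_detectability_necessity (nx ny np N : ℕ)
    (hnx : 0 < nx) (hny : 0 < ny) (hnp : 0 < np) (hN : 0 < N)
    (Pset : Set (Fin np → ℝ)) (hPc : IsCompact Pset)
    (ξ : Fin N → Pset → ℝ)
    (hξc : ∀ i, Continuous (ξ i))
    (hξ0 : ∀ i π, 0 ≤ ξ i π)
    (hξ1 : ∀ π, ∑ i, ξ i π = 1)
    (hstrict : ∀ i : Fin N, ∃ π : Pset, ∀ j, ξ j π = if j = i then 1 else 0)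
    (A : Fin N → Matrix (Fin nx) (Fin nx) ℝ)
    (C : Matrix (Fin ny) (Fin nx) ℝ)
    (hdet : PolyQDetectable nx ny np N Pset ξ A C) :
    ∃ Pb : Fin N → Matrix (Fin nx) (Fin nx) ℝ,
      (∀ i, (Pb i).PosDef) ∧
      ∀ i j, (Pb i - (A i)ᵀ * Pb j * A i + Cᵀ * C).PosDef := by
  obtain ⟨L, P, hsymm, a₁, a₂, a₃, h₁, h₂, h₃, hbound, hdec⟩ := hdet
  choose v hv using hstrict
  have hvertex : ∀ (M : Fin N → Matrix (Fin nx) (Fin nx) ℝ) i,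
      ∑ j, ξ j (v i) • M j = M i := by
    intro M i
    simp [hv]
  have hself : ∀ e : Fin nx → ℝ, 0 ≤ e ⬝ᵥ e := fun e => by
    simpa using dotProduct_star_self_nonneg e
  have hself_pos : ∀ e : Fin nx → ℝ, e ≠ 0 → 0 < e ⬝ᵥ e := fun e he => by
    simpa using dotProduct_star_self_pos_iff.2 he
  have hPlow : ∀ i e, a₁ * (e ⬝ᵥ e) ≤ e ⬝ᵥ (P i *ᵥ e) := fun i e => by
    simpa only [hvertex] using (hbound (v i) e).1
  have hPup : ∀ i e, e ⬝ᵥ (P i *ᵥ e) ≤ a₂ * (e ⬝ᵥ e) := fun i e => by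
    simpa only [hvertex] using (hbound (v i) e).2
  have hpenalty : ∀ i j, ∃ c : ℝ, 0 ≤ c ∧ ∀ e, (A i *ᵥ e) ⬝ᵥ (P j *ᵥ (A i *ᵥ e)) ≤
      e ⬝ᵥ (P i *ᵥ e) - a₃ / 2 * (e ⬝ᵥ e) + c * ((C *ᵥ e) ⬝ᵥ (C *ᵥ e)) := fun i j =>
    exists_output_penalty (hsymm j) h₃ h₂
      (fun e => (mul_nonneg h₁.le (hself e)).trans (hPlow j e)) (hPup j) (hPup i)
      (fun e => by
        have h := hdec (fun k => if k = 0 then v i else v j) 0 e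
        simp only [zero_add, one_ne_zero, if_true, if_false, hvertex] at h
        exact h)
  choose c hc hdecay using hpenalty
  set γ : ℝ := 1 + ∑ i, ∑ j, c i j with hγ
  have hγpos : 0 < γ := by
    have : 0 ≤ ∑ i, ∑ j, c i j := Finset.sum_nonneg fun i _ => Finset.sum_nonneg fun j _ => hc i j
    linarith
  have hcγ : ∀ i j, c i j ≤ γ := fun i j => by
    have hj := Finset.single_le_sum (fun j _ => hc i j) (Finset.mem_univ j)
    have hi := Finset.single_le_sum (f := fun i => ∑ j, c i j)
      (fun i _ => Finset.sum_nonneg fun j _ => hc i j) (Finset.mem_univ i)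
    linarith
  have hPpos : ∀ i, (P i).PosDef := fun i =>
    .of_dotProduct_mulVec_pos (by simpa [IsHermitian] using (hsymm i).eq) fun e he => by
      simpa using (mul_pos h₁ (hself_pos e he)).trans_le (hPlow i e)
  have hform : ∀ i j, (P i - (A i)ᵀ * P j * A i + γ • (Cᵀ * C)).PosDef := fun i j => by
    refine .of_dotProduct_mulVec_pos ?_ fun e he => ?_
    · simp [IsHermitian, (hsymm _).eq, Matrix.mul_assoc]
    · have hCe : 0 ≤ (C *ᵥ e) ⬝ᵥ (C *ᵥ e) := by
        simpa using dotProduct_star_self_nonneg (C *ᵥ e)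
      have hd := hdecay i j e
      have hcC := mul_le_mul_of_nonneg_right (hcγ i j) hCe
      have hpos := mul_pos (half_pos h₃) (hself_pos e he)
      have hAt : e ⬝ᵥ (((A i)ᵀ * P j * A i) *ᵥ e) = (A i *ᵥ e) ⬝ᵥ (P j *ᵥ (A i *ᵥ e)) := by
        rw [Matrix.mul_assoc, ← mulVec_mulVec, dotProduct_mulVec, vecMul_transpose,
          ← mulVec_mulVec]
      have hCt : e ⬝ᵥ ((Cᵀ * C) *ᵥ e) = (C *ᵥ e) ⬝ᵥ (C *ᵥ e) := by
        rw [← mulVec_mulVec, dotProduct_mulVec, vecMul_transpose]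
      simp only [star_trivial, add_mulVec, sub_mulVec, smul_mulVec, dotProduct_add,
        dotProduct_sub, dotProduct_smul, smul_eq_mul, hAt, hCt]
      linarith
  refine ⟨fun i => γ⁻¹ • P i, fun i => (hPpos i).smul (inv_pos.2 hγpos), fun i j => ?_⟩
  have h := (hform i j).smul (inv_pos.2 hγpos)
  rwa [smul_add, smul_sub, smul_smul, inv_mul_cancel₀ hγpos.ne', one_smul,
    ← Matrix.smul_mul, ← Matrix.mul_smul] at h
end

section
/- Suppose there exist symmetric matrices S̄_i ∈ ℝ^{n_x×n_x} and matrices X_i ∈ ℝ^{n_x×n_x} (i = 1,…,N) such that the 2×2 block matrix [[X_i + X_iᵀ − A_iS̄_iA_iᵀ + BBᵀ, X_iᵀ],[X_i, S̄_j]] is positive definite for all i, j ∈ {1,…,N}. Then the polytopic system with input matrix B is poly-quadratically stabilizable; moreover, each S̄_i is positive definite and, with S(π) := (Σ_{i=1}^N ξ_i(π)S̄_i⁻¹)⁻¹, the feedback gain K(k,p) := −Bᵀ(S(p_{k+1}) + BBᵀ)⁻¹A(p_k) renders the closed-loop system x_{k+1} = (A(p_k) + BK(k,p))x_k poly-quadratically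 stable with poly-quadratic Lyapunov function V(π,x) = xᵀP(π)x where P(π) = Σ_{i=1}^N ξ_i(π)S̄_i⁻¹. -/
open Matrix

/-- A feedback gain `K(k,p)` renders the closed-loop system
`x_{k+1} = (A(p_k) + BK(k,p))x_k` poly-quadratically stable with poly-quadratic
Lyapunov function `V(π,x) = xᵀP(π)x`, `P(π) = Σᵢ ξᵢ(π)P̄ᵢ`. -/
def RendersClosedLoopPolyQS (nx nu np N : ℕ) (Pset : Set (Fin np → ℝ))
    (ξ : Fin N → Pset → ℝ) (A : Fin N → Matrix (Fin nx) (Fin nx) ℝ)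
    (B : Matrix (Fin nx) (Fin nu) ℝ)
    (K : ℕ → (ℕ → Pset) → Matrix (Fin nu) (Fin nx) ℝ)
    (Pb : Fin N → Matrix (Fin nx) (Fin nx) ℝ) : Prop :=
  ∃ a₁ a₂ a₃ : ℝ, 0 < a₁ ∧ 0 < a₂ ∧ 0 < a₃ ∧
    (∀ (π : Pset) (x : Fin nx → ℝ),
      a₁ * (x ⬝ᵥ x) ≤ x ⬝ᵥ ((∑ i, ξ i π • Pb i) *ᵥ x) ∧
      x ⬝ᵥ ((∑ i, ξ i π • Pb i) *ᵥ x) ≤ a₂ * (x ⬝ᵥ x)) ∧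
    (∀ (p : ℕ → Pset) (k : ℕ) (x : Fin nx → ℝ),
      (((∑ i, ξ i (p k) • A i) + B * K k p) *ᵥ x) ⬝ᵥ
          ((∑ i, ξ i (p (k + 1)) • Pb i) *ᵥ
            (((∑ i, ξ i (p k) • A i) + B * K k p) *ᵥ x))
        ≤ x ⬝ᵥ ((∑ i, ξ i (p k) • Pb i) *ᵥ x) - a₃ * (x ⬝ᵥ x))

/-- The polytopic system with input matrix `B` is poly-quadratically
stabilizable. -/
def PolyQStabilizable (nx nu np N : ℕ) (Pset : Set (Fin np → ℝ))
    (ξ : Fin N → Pset → ℝ) (A : Fin N → Matrix (Fin nx) (Fin nx) ℝ)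
    (B : Matrix (Fin nx) (Fin nu) ℝ) : Prop :=
  ∃ (K : ℕ → (ℕ → Pset) → Matrix (Fin nu) (Fin nx) ℝ)
    (Pb : Fin N → Matrix (Fin nx) (Fin nx) ℝ),
    (∀ i, (Pb i).IsSymm) ∧ RendersClosedLoopPolyQS nx nu np N Pset ξ A B K Pb

section QuadraticForms

variable {m n ι : Type*} [Fintype m] [Fintype n] [Fintype ι]

/-- A linear combination of matrices acts on pairs of vectors by the linear combination of the
corresponding bilinear forms. -/
theorem dotProduct_sum_smul_mulVec (c : ι → ℝ) (M : ι → Matrix m n ℝ) (x : m → ℝ) (y : n → ℝ) :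
    x ⬝ᵥ ((∑ i, c i • M i) *ᵥ y) = ∑ i, c i * (x ⬝ᵥ (M i *ᵥ y)) := by
  simp [Matrix.sum_mulVec, Matrix.smul_mulVec, dotProduct_sum]

/-- Young's inequality for the bilinear form of a positive semidefinite matrix. -/
theorem Matrix.PosSemidef.two_mul_dotProduct_mulVec_le {M : Matrix n n ℝ} (hM : M.PosSemidef)
    (x y : n → ℝ) : 2 * (x ⬝ᵥ (M *ᵥ y)) ≤ x ⬝ᵥ (M *ᵥ x) + y ⬝ᵥ (M *ᵥ y) := by
  have h := hM.dotProduct_mulVec_nonneg (x - y)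
  have hs : y ⬝ᵥ (M *ᵥ x) = x ⬝ᵥ (M *ᵥ y) := by
    have hT : Mᵀ = M := by simpa using hM.isHermitian.eq
    rw [← dotProduct_transpose_mulVec, hT]
  simp only [star_trivial, mulVec_sub, dotProduct_sub, sub_dotProduct] at h
  linarith

theorem Matrix.exists_dotProduct_mulVec_le (M : Matrix n n ℝ) :
    ∃ C : ℝ, 0 < C ∧ ∀ x : n → ℝ, x ⬝ᵥ (M *ᵥ x) ≤ C * (x ⬝ᵥ x) := by
  refine ⟨1 + ∑ i, ∑ j, |M i j|, by positivity, fun x => ?_⟩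
  have hx : 0 ≤ x ⬝ᵥ x := by simpa using dotProduct_star_self_nonneg x
  have hi : ∀ i, x i * x i ≤ x ⬝ᵥ x := fun i =>
    Finset.single_le_sum (f := fun i => x i * x i) (fun i _ => mul_self_nonneg _)
      (Finset.mem_univ i)
  have hterm : ∀ i j, x i * (M i j * x j) ≤ |M i j| * (x ⬝ᵥ x) := fun i j => by
    have hxy : |x i * x j| ≤ x ⬝ᵥ x := by
      rw [abs_le]
      constructor <;>
        nlinarith [hi i, hi j, mul_self_nonneg (x i - x j), mul_self_nonneg (x i + x j)]
    calc x i * (M i j * x j) ≤ |x i * (M i j * x j)| := le_abs_self _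
      _ = |M i j| * |x i * x j| := by rw [← abs_mul]; ring_nf
      _ ≤ |M i j| * (x ⬝ᵥ x) := by gcongr
  have hsum : x ⬝ᵥ (M *ᵥ x) ≤ (∑ i, ∑ j, |M i j|) * (x ⬝ᵥ x) := by
    simp only [Finset.sum_mul]
    simp only [dotProduct, mulVec, Finset.mul_sum] at hterm ⊢
    exact Finset.sum_le_sum fun i _ => Finset.sum_le_sum fun j _ => hterm i j
  linarith

theorem Matrix.PosDef.mulVec_inv_mulVec [DecidableEq n] {M : Matrix n n ℝ} (hM : M.PosDef) (x : n → ℝ) :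
    M *ᵥ (M⁻¹ *ᵥ x) = x := by
  rw [mulVec_mulVec, mul_nonsing_inv _ ((isUnit_iff_isUnit_det _).1 hM.isUnit), one_mulVec]

theorem Matrix.PosDef.exists_dotProduct_self_le [DecidableEq n] {M : Matrix n n ℝ}
    (hM : M.PosDef) : ∃ C : ℝ, 0 < C ∧ ∀ x : n → ℝ, x ⬝ᵥ x ≤ C * (x ⬝ᵥ (M *ᵥ x)) := by
  obtain ⟨C, hC, hle⟩ := M⁻¹.exists_dotProduct_mulVec_le
  refine ⟨C, hC, fun x => ?_⟩
  have hy := hM.posSemidef.two_mul_dotProduct_mulVec_le (C • x) (M⁻¹ *ᵥ x)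
  rw [hM.mulVec_inv_mulVec] at hy
  simp only [mulVec_smul, dotProduct_smul, smul_dotProduct, smul_eq_mul] at hy
  rw [dotProduct_comm (M⁻¹ *ᵥ x)] at hy
  refine le_of_mul_le_mul_left ?_ hC
  linarith [hle x]

/-- A finite family of matrices has a common upper bound for its quadratic forms. -/
theorem Matrix.exists_forall_dotProduct_mulVec_le (M : ι → Matrix n n ℝ) :
    ∃ C : ℝ, 0 < C ∧ ∀ i (x : n → ℝ), x ⬝ᵥ (M i *ᵥ x) ≤ C * (x ⬝ᵥ x) := by
  choose C hC hle using fun i => (M i).exists_dotProduct_mulVec_le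
  have hpos : 0 < 1 + ∑ i, C i := by
    have := Finset.sum_nonneg fun i (_ : i ∈ Finset.univ) => (hC i).le
    linarith
  refine ⟨1 + ∑ i, C i, hpos, fun i x => (hle i x).trans ?_⟩
  have hx : 0 ≤ x ⬝ᵥ x := by simpa using dotProduct_star_self_nonneg x
  have := Finset.single_le_sum (f := C) (fun i _ => (hC i).le) (Finset.mem_univ i)
  gcongr
  linarith

/-- A finite family of positive definite matrices is uniformly positive definite. -/
theorem Matrix.exists_forall_mul_dotProduct_self_le [DecidableEq n] {M : ι → Matrix n n ℝ}
    (hM : ∀ i, (M i).PosDef) :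
    ∃ c : ℝ, 0 < c ∧ ∀ i (x : n → ℝ), c * (x ⬝ᵥ x) ≤ x ⬝ᵥ (M i *ᵥ x) := by
  choose C hC hle using fun i => (hM i).exists_dotProduct_self_le
  have hpos : 0 < 1 + ∑ i, C i := by
    have := Finset.sum_nonneg fun i (_ : i ∈ Finset.univ) => (hC i).le
    linarith
  refine ⟨(1 + ∑ i, C i)⁻¹, inv_pos.2 hpos, fun i x => ?_⟩
  rw [inv_mul_le_iff₀ hpos]
  refine (hle i x).trans ?_
  have hx : 0 ≤ x ⬝ᵥ (M i *ᵥ x) := by simpa using (hM i).posSemidef.dotProduct_mulVec_nonneg x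
  have := Finset.single_le_sum (f := C) (fun i _ => (hC i).le) (Finset.mem_univ i)
  gcongr
  linarith

end QuadraticForms

section ConvexCombinations

variable {m n ι : Type*} [Fintype m] [Fintype n] [DecidableEq n] [Fintype ι]

theorem Matrix.PosDef.sum_smul {Q : ι → Matrix n n ℝ} (hQ : ∀ i, (Q i).PosDef) {c : ι → ℝ}
    (hc0 : ∀ i, 0 ≤ c i) (hc1 : ∑ i, c i = 1) : (∑ i, c i • Q i).PosDef := by
  obtain ⟨a, ha, hle⟩ := Matrix.exists_forall_mul_dotProduct_self_le hQ
  refine .of_dotProduct_mulVec_pos ?_ fun x hx => ?_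
  · exact (posSemidef_sum _ fun i _ => (hQ i).posSemidef.smul (hc0 i)).isHermitian
  · have hxx : 0 < x ⬝ᵥ x := by simpa using dotProduct_star_self_pos_iff.2 hx
    rw [star_trivial, dotProduct_sum_smul_mulVec]
    calc 0 < a * (x ⬝ᵥ x) := by positivity
      _ = ∑ i, c i * (a * (x ⬝ᵥ x)) := by rw [← Finset.sum_mul, hc1, one_mul]
      _ ≤ _ := Finset.sum_le_sum fun i _ => mul_le_mul_of_nonneg_left (hle i x) (hc0 i)

/-- Averaging the slack-variable matrix inequalities over `j`, evaluated at the vectors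
`(y, -(S j)⁻¹ w)` with `w = (∑ j, c j • (S j)⁻¹)⁻¹ y`, eliminates the slack variable `X`. -/
theorem slack_elimination {S : ι → Matrix n n ℝ} (hS : ∀ i, (S i).PosDef)
    {c : ι → ℝ} (hc0 : ∀ i, 0 ≤ c i) (hc1 : ∑ i, c i = 1) (Y X : Matrix n n ℝ) {ε : ℝ}
    (hε : 0 ≤ ε)
    (hle : ∀ j (x : n ⊕ n → ℝ),
      ε * (x ⬝ᵥ x) ≤ x ⬝ᵥ (fromBlocks (X + Xᵀ + Y) Xᵀ X (S j) *ᵥ x))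
    (y : n → ℝ) :
    ε * (y ⬝ᵥ y) ≤ y ⬝ᵥ ((∑ j, c j • (S j)⁻¹)⁻¹ *ᵥ y) + y ⬝ᵥ (Y *ᵥ y) := by
  have hP : (∑ j, c j • (S j)⁻¹).PosDef := .sum_smul (fun i => (hS i).inv) hc0 hc1
  set P := ∑ j, c j • (S j)⁻¹ with hPdef
  set w := P⁻¹ *ᵥ y with hw
  have hPw : P *ᵥ w = y := hP.mulVec_inv_mulVec y
  have hj : ∀ j, ε * (y ⬝ᵥ y) ≤ 2 * (y ⬝ᵥ (X *ᵥ y)) + y ⬝ᵥ (Y *ᵥ y)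
      - 2 * ((X *ᵥ y) ⬝ᵥ ((S j)⁻¹ *ᵥ w)) + w ⬝ᵥ ((S j)⁻¹ *ᵥ w) := fun j => by
    have h := hle j (Sum.elim y (-((S j)⁻¹ *ᵥ w)))
    rw [fromBlocks_mulVec] at h
    simp only [sumElim_dotProduct_sumElim, Sum.elim_comp_inl, Sum.elim_comp_inr, add_mulVec,
      mulVec_neg, dotProduct_add, dotProduct_neg, neg_dotProduct, neg_neg,
      (hS j).mulVec_inv_mulVec, dotProduct_transpose_mulVec] at h
    have hz : 0 ≤ ((S j)⁻¹ *ᵥ w) ⬝ᵥ ((S j)⁻¹ *ᵥ w) := by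
      simpa using dotProduct_star_self_nonneg ((S j)⁻¹ *ᵥ w)
    rw [dotProduct_comm ((S j)⁻¹ *ᵥ w) (X *ᵥ y), dotProduct_comm ((S j)⁻¹ *ᵥ w) w] at h
    nlinarith [mul_nonneg hε hz]
  have hsum := Finset.sum_le_sum fun j (_ : j ∈ Finset.univ) =>
    mul_le_mul_of_nonneg_left (hj j) (hc0 j)
  have hXw := dotProduct_sum_smul_mulVec c (fun j => (S j)⁻¹) (X *ᵥ y) w
  have hww := dotProduct_sum_smul_mulVec c (fun j => (S j)⁻¹) w w
  rw [← hPdef, hPw] at hXw hww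
  simp only [mul_add, mul_sub, Finset.sum_add_distrib, Finset.sum_sub_distrib,
    ← Finset.sum_mul, hc1, one_mul, mul_left_comm (c _) 2, ← Finset.mul_sum, ← hXw, ← hww] at hsum
  rw [dotProduct_comm (X *ᵥ y) y, dotProduct_comm w y] at hsum
  linarith

/-- A quadratic form bounded below by `a` has an inverse bounded above by `a⁻¹`. -/
theorem Matrix.PosDef.mul_dotProduct_inv_mulVec_le {P : Matrix n n ℝ} (hP : P.PosDef) {a : ℝ}
    (hle : ∀ x : n → ℝ, a * (x ⬝ᵥ x) ≤ x ⬝ᵥ (P *ᵥ x)) (y : n → ℝ) :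
    a * (y ⬝ᵥ (P⁻¹ *ᵥ y)) ≤ y ⬝ᵥ y := by
  have h := hle (P⁻¹ *ᵥ y)
  rw [hP.mulVec_inv_mulVec, dotProduct_comm _ y] at h
  have hsq : 0 ≤ (y - a • (P⁻¹ *ᵥ y)) ⬝ᵥ (y - a • (P⁻¹ *ᵥ y)) := by
    simpa using dotProduct_star_self_nonneg (y - a • (P⁻¹ *ᵥ y))
  simp only [dotProduct_sub, sub_dotProduct, smul_dotProduct, dotProduct_smul, smul_eq_mul,
    dotProduct_comm _ y] at hsq
  by_cases ha : 0 ≤ a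
  · nlinarith [mul_le_mul_of_nonneg_left h ha]
  · have h1 : 0 ≤ y ⬝ᵥ (P⁻¹ *ᵥ y) := by
      simpa using hP.inv.posSemidef.dotProduct_mulVec_nonneg y
    have h2 : 0 ≤ y ⬝ᵥ y := by simpa using dotProduct_star_self_nonneg y
    nlinarith

/-- If `A i * S i * (A i)ᵀ + ε ≤ G` for all `i`, then `y = G⁻¹ A x`, with `A` a convex combination
of the `A i`, satisfies `yᵀ G y ≤ xᵀ P x - ε yᵀ y`, where `P` is the same convex combination of the
`(S i)⁻¹`. -/
theorem dotProduct_mulVec_le_of_mulVec_eq {S A : ι → Matrix n n ℝ} (hS : ∀ i, (S i).PosDef)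
    {c : ι → ℝ} (hc0 : ∀ i, 0 ≤ c i) (hc1 : ∑ i, c i = 1) {G : Matrix n n ℝ} {ε : ℝ}
    {x y : n → ℝ}
    (hle : ∀ i, y ⬝ᵥ ((A i * S i * (A i)ᵀ) *ᵥ y) + ε * (y ⬝ᵥ y) ≤ y ⬝ᵥ (G *ᵥ y))
    (hxy : G *ᵥ y = (∑ i, c i • A i) *ᵥ x) :
    y ⬝ᵥ (G *ᵥ y) ≤ x ⬝ᵥ ((∑ i, c i • (S i)⁻¹) *ᵥ x) - ε * (y ⬝ᵥ y) := by
  have hi : ∀ i, 2 * (y ⬝ᵥ (A i *ᵥ x)) ≤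
      y ⬝ᵥ (G *ᵥ y) - ε * (y ⬝ᵥ y) + x ⬝ᵥ ((S i)⁻¹ *ᵥ x) := fun i => by
    have h := (hS i).posSemidef.two_mul_dotProduct_mulVec_le ((A i)ᵀ *ᵥ y) ((S i)⁻¹ *ᵥ x)
    rw [(hS i).mulVec_inv_mulVec, dotProduct_comm _ x, dotProduct_transpose_mulVec,
      dotProduct_comm _ x, dotProduct_comm ((A i)ᵀ *ᵥ y), dotProduct_transpose_mulVec,
      mulVec_mulVec, mulVec_mulVec] at h
    linarith [hle i]
  have hsum := Finset.sum_le_sum fun i (_ : i ∈ Finset.univ) =>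
    mul_le_mul_of_nonneg_left (hi i) (hc0 i)
  simp only [mul_add, mul_sub, Finset.sum_add_distrib, Finset.sum_sub_distrib,
    ← Finset.sum_mul, hc1, one_mul, mul_left_comm (c _) 2, ← Finset.mul_sum,
    ← dotProduct_sum_smul_mulVec, ← hxy] at hsum
  linarith

/-- Under the gain `-Bᵀ G⁻¹ A` with `G = T + B Bᵀ`, the closed-loop matrix is `T G⁻¹ A`. -/
theorem add_mul_neg_gain_mulVec {T A : Matrix n n ℝ} {B : Matrix n m ℝ}
    (hG : (T + B * Bᵀ).PosDef) (x : n → ℝ) :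
    (A + B * -(Bᵀ * (T + B * Bᵀ)⁻¹ * A)) *ᵥ x = T *ᵥ ((T + B * Bᵀ)⁻¹ *ᵥ (A *ᵥ x)) := by
  have h := hG.mulVec_inv_mulVec (A *ᵥ x)
  rw [add_mulVec] at h
  have hB : (B * -(Bᵀ * (T + B * Bᵀ)⁻¹ * A)) *ᵥ x =
      -((B * Bᵀ) *ᵥ ((T + B * Bᵀ)⁻¹ *ᵥ (A *ᵥ x))) := by
    simp only [Matrix.mul_neg, neg_mulVec, mulVec_mulVec, Matrix.mul_assoc]
  rw [add_mulVec, hB, ← sub_eq_add_neg, sub_eq_iff_eq_add]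
  exact h.symm

end ConvexCombinations

/-- Theorem 3: the slack-variable LMIs imply poly-quadratic stabilizability;
moreover each `S̄ᵢ` is positive definite and the gain
`K(k,p) = -Bᵀ(S(p_{k+1}) + BBᵀ)⁻¹A(p_k)`, with `S(π) = (Σᵢ ξᵢ(π)S̄ᵢ⁻¹)⁻¹`,
renders the closed-loop system poly-quadratically stable with poly-QLF
`V(π,x) = xᵀP(π)x`, `P(π) = Σᵢ ξᵢ(π)S̄ᵢ⁻¹`. -/
theorem polyQ_stabilizability_analysis (nx nu np N : ℕ)
    (hnx : 0 < nx) (hnu : 0 < nu) (hnp : 0 < np) (hN : 0 < N)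
    (Pset : Set (Fin np → ℝ)) (hPc : IsCompact Pset)
    (ξ : Fin N → Pset → ℝ)
    (hξc : ∀ i, Continuous (ξ i))
    (hξ0 : ∀ i π, 0 ≤ ξ i π)
    (hξ1 : ∀ π, ∑ i, ξ i π = 1)
    (A : Fin N → Matrix (Fin nx) (Fin nx) ℝ)
    (B : Matrix (Fin nx) (Fin nu) ℝ)
    (S X : Fin N → Matrix (Fin nx) (Fin nx) ℝ)
    (hSsymm : ∀ i, (S i).IsSymm)
    (hLMI : ∀ i j, (fromBlocks (X i + (X i)ᵀ - A i * S i * (A i)ᵀ + B * Bᵀ)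
        ((X i)ᵀ) (X i) (S j)).PosDef) :
    (∀ i, (S i).PosDef) ∧
    PolyQStabilizable nx nu np N Pset ξ A B ∧
    RendersClosedLoopPolyQS nx nu np N Pset ξ A B
      (fun k p =>
        -(Bᵀ * ((∑ i, ξ i (p (k + 1)) • (S i)⁻¹)⁻¹ + B * Bᵀ)⁻¹ *
          (∑ i, ξ i (p k) • A i)))
      (fun i => (S i)⁻¹) := by
  have hSpos : ∀ i, (S i).PosDef := fun i =>
    (hLMI i i).submatrix (e := Sum.inr) Sum.inr_injective
  have hQ : ∀ i, ((S i)⁻¹).PosDef := fun i => (hSpos i).inv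
  have hRender : RendersClosedLoopPolyQS nx nu np N Pset ξ A B
      (fun k p =>
        -(Bᵀ * ((∑ i, ξ i (p (k + 1)) • (S i)⁻¹)⁻¹ + B * Bᵀ)⁻¹ *
          (∑ i, ξ i (p k) • A i)))
      (fun i => (S i)⁻¹) := by
    obtain ⟨a₁, ha₁, hlow⟩ := Matrix.exists_forall_mul_dotProduct_self_le hQ
    obtain ⟨a₂, ha₂, hupp⟩ := Matrix.exists_forall_dotProduct_mulVec_le fun i => (S i)⁻¹
    obtain ⟨ε, hε, hLMIε⟩ := Matrix.exists_forall_mul_dotProduct_self_le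
      (fun q : Fin N × Fin N => hLMI q.1 q.2)
    have hP₁ : ∀ (π : Pset) (x : Fin nx → ℝ),
        a₁ * (x ⬝ᵥ x) ≤ x ⬝ᵥ ((∑ i, ξ i π • (S i)⁻¹) *ᵥ x) := fun π x => by
      rw [dotProduct_sum_smul_mulVec]
      calc a₁ * (x ⬝ᵥ x) = ∑ i, ξ i π * (a₁ * (x ⬝ᵥ x)) := by
            rw [← Finset.sum_mul, hξ1, one_mul]
        _ ≤ _ := Finset.sum_le_sum fun i _ => mul_le_mul_of_nonneg_left (hlow i x) (hξ0 i π)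
    have hP₂ : ∀ (π : Pset) (x : Fin nx → ℝ),
        x ⬝ᵥ ((∑ i, ξ i π • (S i)⁻¹) *ᵥ x) ≤ a₂ * (x ⬝ᵥ x) := fun π x => by
      rw [dotProduct_sum_smul_mulVec]
      calc _ ≤ ∑ i, ξ i π * (a₂ * (x ⬝ᵥ x)) :=
            Finset.sum_le_sum fun i _ => mul_le_mul_of_nonneg_left (hupp i x) (hξ0 i π)
        _ = _ := by rw [← Finset.sum_mul, hξ1, one_mul]
    have hδ : 0 < 1 + ε * a₁ := by positivity
    refine ⟨a₁, a₂, ε * a₁ / (1 + ε * a₁) * a₁, ha₁, ha₂, by positivity,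
      fun π x => ⟨hP₁ π x, hP₂ π x⟩, fun p k x => ?_⟩
    have hPpos : (∑ i, ξ i (p (k + 1)) • (S i)⁻¹).PosDef :=
      .sum_smul hQ (fun i => hξ0 i _) (hξ1 _)
    have hBB : (B * Bᵀ).PosSemidef := by simpa using posSemidef_self_mul_conjTranspose B
    have hG := hPpos.inv.add_posSemidef hBB
    simp only [add_mul_neg_gain_mulVec hG]
    set P := ∑ i, ξ i (p (k + 1)) • (S i)⁻¹ with hP
    set y := (P⁻¹ + B * Bᵀ)⁻¹ *ᵥ ((∑ i, ξ i (p k) • A i) *ᵥ x) with hy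
    rw [hPpos.mulVec_inv_mulVec, dotProduct_comm _ y]
    have hdecay := dotProduct_mulVec_le_of_mulVec_eq (A := A) (G := P⁻¹ + B * Bᵀ) (ε := ε)
      (x := x) (y := y) hSpos (fun i => hξ0 i (p k)) (hξ1 (p k))
      (fun i => by
        have h := slack_elimination hSpos (fun j => hξ0 j (p (k + 1))) (hξ1 (p (k + 1)))
          (B * Bᵀ - A i * S i * (A i)ᵀ) (X i) hε.le
          (fun j z => by
            have h := hLMIε (i, j) z
            rwa [show X i + (X i)ᵀ - A i * S i * (A i)ᵀ + B * Bᵀ =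
              X i + (X i)ᵀ + (B * Bᵀ - A i * S i * (A i)ᵀ) by abel] at h) y
        rw [sub_mulVec, dotProduct_sub] at h
        rw [add_mulVec, dotProduct_add]
        linarith)
      (hG.mulVec_inv_mulVec _)
    rw [add_mulVec, dotProduct_add] at hdecay
    have hBy : 0 ≤ y ⬝ᵥ ((B * Bᵀ) *ᵥ y) := by simpa using hBB.dotProduct_mulVec_nonneg y
    have hyy := mul_le_mul_of_nonneg_left
      (hPpos.mul_dotProduct_inv_mulVec_le (hP₁ (p (k + 1))) y) hε.le
    have hmain : (1 + ε * a₁) * (y ⬝ᵥ (P⁻¹ *ᵥ y)) ≤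
        x ⬝ᵥ ((∑ i, ξ i (p k) • (S i)⁻¹) *ᵥ x) := by linarith
    have hx := mul_le_mul_of_nonneg_left (hP₁ (p k) x) (mul_pos hε ha₁).le
    refine le_of_mul_le_mul_left ?_ hδ
    have hcancel : (1 + ε * a₁) * (ε * a₁ / (1 + ε * a₁) * a₁ * (x ⬝ᵥ x)) =
        ε * a₁ * (a₁ * (x ⬝ᵥ x)) := by field_simp
    rw [mul_sub, hcancel]
    linarith
  exact ⟨hSpos, ⟨_, _, fun i => by simpa using (hQ i).isHermitian, hRender⟩, hRender⟩
end
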